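/- Let k be a field, m ≥ 3, n ≥ m + 1, and work in R = k[x_{ij} : 1 ≤ i ≤ m, 1 ≤ j ≤ n]. Define A' to be the ideal generated by the monomials (∏_{i=1}^{k_1} x_{1i})(∏_{i=k_1+1}^{k_2} x_{2i})(∏_{i=k_2+2}^{k_3} x_{3i})⋯(∏_{i=k_{m−3}+2}^{k_{m−2}} x_{m−2,i})(∏_{i=k_{m−2}+2}^{n−2} x_{m−1,i}), over all 0 ≤ k_1 ≤ k_2 < k_3 < ⋯ < k_{m−2} < n−2, and C' to be the ideal generated by the monomials (∏_{i=1}^{k_1} x_{1i})(∏_{i=k_1+1}^{k_2} x_{2i})(∏_{i=k_2+2}^{k_3} x_{3i})⋯(∏_{i=k_{m−2}+2}^{k_{m−1}} x_{m−1,i})(∏_{i=k_{m−1}+2}^{n−1} x_{m,i}), over all 0 ≤ k_1 ≤ k_2 < k_3 < ⋯ < k_{m−1} ≤ n−3 (empty products equal 1). Then A' ∩ C' = A' · (x_{m,n−1}). -/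

import Mathlib

open MvPolynomial Finset

/-- The index of the entry in row `i`, column `j` (1-based) of an `m × n` matrix of variables. -/
def ent (m n : ℕ) (hm : 0 < m) (hn : 0 < n) (i j : ℕ) : Fin m × Fin n :=
  (⟨(i - 1) % m, Nat.mod_lt _ hm⟩, ⟨(j - 1) % n, Nat.mod_lt _ hn⟩)

/-- If no exponent of the monomials in `S` involves the variable `e`, then intersecting the
monomial ideal `span S` with `(X e)` is the same as multiplying by it. -/
theorem span_inf_span_X_le_mul {σ k : Type*} [Field k] (S : Set (MvPolynomial σ k)) (e : σ)
    (hS : ∀ g ∈ S, ∃ s : σ →₀ ℕ, s e = 0 ∧ g = monomial s 1) :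
    Ideal.span S ⊓ Ideal.span {(X e : MvPolynomial σ k)} ≤
      Ideal.span S * Ideal.span {(X e : MvPolynomial σ k)} := by
  classical
  intro f hf
  obtain ⟨hfS, hfe⟩ := Ideal.mem_inf.1 hf
  obtain ⟨h, rfl⟩ := Ideal.mem_span_singleton.1 hfe
  rw [mul_comm (X e) h]
  refine Ideal.mul_mem_mul ?_ (Ideal.mem_span_singleton_self _)
  have hST : S = (fun s => monomial s (1 : k)) '' {s | s e = 0 ∧ monomial s (1 : k) ∈ S} := by
    ext g
    constructor
    · intro hg
      obtain ⟨s, hs, rfl⟩ := hS g hg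
      exact ⟨s, ⟨hs, hg⟩, rfl⟩
    · rintro ⟨s, ⟨-, hs⟩, rfl⟩
      exact hs
  rw [hST] at hfS ⊢
  rw [mem_ideal_span_monomial_image] at hfS
  rw [mem_ideal_span_monomial_image]
  intro t ht
  obtain ⟨s, hs, hst⟩ := hfS (Finsupp.single e 1 + t) (by
    rw [mem_support_iff, coeff_X_mul]
    exact mem_support_iff.1 ht)
  refine ⟨s, hs, Finsupp.le_def.2 fun i => ?_⟩
  by_cases hi : i = e
  · rw [hi, hs.1]
    exact Nat.zero_le _
  · simpa [Finsupp.single_apply, Ne.symm hi] using Finsupp.le_def.1 hst i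

/-- A product of variables all different from `X e` is a monomial not involving `X e`. -/
theorem exists_monomial_eq_prod_X {σ k ι : Type*} [Field k] (e : σ) (t : Finset ι) (v : ι → σ)
    (hv : ∀ i ∈ t, v i ≠ e) :
    ∃ s : σ →₀ ℕ, s e = 0 ∧ ∏ i ∈ t, (X (v i) : MvPolynomial σ k) = monomial s 1 := by
  classical
  refine ⟨∑ i ∈ t, Finsupp.single (v i) 1, ?_, ?_⟩
  · rw [Finsupp.finsetSum_apply]
    exact Finset.sum_eq_zero fun i hi => Finsupp.single_eq_of_ne (hv i hi).symm
  · rw [monomial_sum_one]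
    rfl

/-- Monomials not involving `X e` are closed under finite products. -/
theorem exists_monomial_eq_prod {σ k ι : Type*} [Field k] (e : σ) (t : Finset ι)
    (f : ι → MvPolynomial σ k)
    (hf : ∀ i ∈ t, ∃ s : σ →₀ ℕ, s e = 0 ∧ f i = monomial s 1) :
    ∃ s : σ →₀ ℕ, s e = 0 ∧ ∏ i ∈ t, f i = monomial s 1 := by
  refine Finset.prod_induction f (fun g => ∃ s : σ →₀ ℕ, s e = 0 ∧ g = monomial s 1) ?_ ?_ hf
  · rintro _ _ ⟨s, hs, rfl⟩ ⟨t, ht, rfl⟩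
    exact ⟨s + t, by simp [hs, ht], by rw [monomial_mul, one_mul]⟩
  · exact ⟨0, rfl, rfl⟩

theorem ent_ne_of_row_lt {m n : ℕ} (hm : 0 < m) (hn : 0 < n) {r : ℕ} (hr : 1 ≤ r) (hrm : r < m)
    (i j : ℕ) : ent m n hm hn r i ≠ ent m n hm hn m j := by
  intro h
  have h' := congrArg (fun p => (p.1 : ℕ)) h
  simp only [ent] at h'
  rw [Nat.mod_eq_of_lt (by omega), Nat.mod_eq_of_lt (by omega)] at h'
  omega

/-- With `A'` and `C'` the ideals of `k[x_{ij} : 1 ≤ i ≤ m, 1 ≤ j ≤ n]` generated by the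
monomials
`(∏_{i=1}^{k₁} x_{1i})(∏_{i=k₁+1}^{k₂} x_{2i})(∏_{i=k₂+2}^{k₃} x_{3i})⋯(∏_{i=k_{m−2}+2}^{n−2} x_{m−1,i})`
(over `0 ≤ k₁ ≤ k₂ < k₃ < ⋯ < k_{m−2} < n−2`), resp.
`(∏_{i=1}^{k₁} x_{1i})(∏_{i=k₁+1}^{k₂} x_{2i})(∏_{i=k₂+2}^{k₃} x_{3i})⋯(∏_{i=k_{m−1}+2}^{n−1} x_{m,i})`
(over `0 ≤ k₁ ≤ k₂ < k₃ < ⋯ < k_{m−1} ≤ n−3`), we have `A' ∩ C' = A'·(x_{m,n−1})`.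
(The sequences are encoded by functions `κ : ℕ → ℕ`, with the fixed values `κ (m−1) = n−2`
resp. `κ m = n−1` recording the upper bound of the last product.) -/
theorem Aprime_inter_Cprime (k : Type*) [Field k] (m n : ℕ) (hm : 3 ≤ m) (hn : m + 1 ≤ n) :
    (Ideal.span {g : MvPolynomial (Fin m × Fin n) k | ∃ κ : ℕ → ℕ, κ 1 ≤ κ 2 ∧
        (∀ r, 2 ≤ r → r + 1 ≤ m - 1 → κ r < κ (r + 1)) ∧ κ (m - 1) = n - 2 ∧
        g = (∏ i ∈ Finset.Icc 1 (κ 1), X (ent m n (by omega) (by omega) 1 i)) *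
            (∏ i ∈ Finset.Icc (κ 1 + 1) (κ 2), X (ent m n (by omega) (by omega) 2 i)) *
            ∏ r ∈ Finset.Icc 3 (m - 1), ∏ i ∈ Finset.Icc (κ (r - 1) + 2) (κ r),
              X (ent m n (by omega) (by omega) r i)} ⊓
      Ideal.span {g : MvPolynomial (Fin m × Fin n) k | ∃ κ : ℕ → ℕ, κ 1 ≤ κ 2 ∧
        (∀ r, 2 ≤ r → r + 1 ≤ m - 1 → κ r < κ (r + 1)) ∧ κ (m - 1) ≤ n - 3 ∧ κ m = n - 1 ∧
        g = (∏ i ∈ Finset.Icc 1 (κ 1), X (ent m n (by omega) (by omega) 1 i)) *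
            (∏ i ∈ Finset.Icc (κ 1 + 1) (κ 2), X (ent m n (by omega) (by omega) 2 i)) *
            ∏ r ∈ Finset.Icc 3 m, ∏ i ∈ Finset.Icc (κ (r - 1) + 2) (κ r),
              X (ent m n (by omega) (by omega) r i)}) =
    Ideal.span {g : MvPolynomial (Fin m × Fin n) k | ∃ κ : ℕ → ℕ, κ 1 ≤ κ 2 ∧
        (∀ r, 2 ≤ r → r + 1 ≤ m - 1 → κ r < κ (r + 1)) ∧ κ (m - 1) = n - 2 ∧
        g = (∏ i ∈ Finset.Icc 1 (κ 1), X (ent m n (by omega) (by omega) 1 i)) *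
            (∏ i ∈ Finset.Icc (κ 1 + 1) (κ 2), X (ent m n (by omega) (by omega) 2 i)) *
            ∏ r ∈ Finset.Icc 3 (m - 1), ∏ i ∈ Finset.Icc (κ (r - 1) + 2) (κ r),
              X (ent m n (by omega) (by omega) r i)} *
      Ideal.span {(X (ent m n (by omega) (by omega) m (n - 1)) :
        MvPolynomial (Fin m × Fin n) k)} := by
  have hm0 : 0 < m := by omega
  have hn0 : 0 < n := by omega
  apply le_antisymm
  · refine le_trans (le_inf inf_le_left (inf_le_right.trans ?_))
      (span_inf_span_X_le_mul _ (ent m n hm0 hn0 m (n - 1)) ?_)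
    · rw [Ideal.span_le]
      rintro g ⟨κ, -, -, hκ, hκm, rfl⟩
      refine Ideal.mem_span_singleton.2 (Dvd.dvd.mul_left ?_ _)
      refine dvd_trans ?_ (Finset.dvd_prod_of_mem _ (Finset.mem_Icc.2 ⟨hm, le_rfl⟩))
      exact Finset.dvd_prod_of_mem (fun i => X (ent m n hm0 hn0 m i))
        (Finset.mem_Icc.2 ⟨by omega, by omega⟩)
    · rintro g ⟨κ, -, -, -, rfl⟩
      have hrow : ∀ r, 1 ≤ r → r < m → ∀ t : Finset ℕ, ∃ s : Fin m × Fin n →₀ ℕ,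
          s (ent m n hm0 hn0 m (n - 1)) = 0 ∧
          ∏ i ∈ t, (X (ent m n hm0 hn0 r i) : MvPolynomial _ k) = monomial s 1 :=
        fun r hr hrm t => exists_monomial_eq_prod_X _ t _ fun i _ =>
          ent_ne_of_row_lt hm0 hn0 hr hrm i _
      obtain ⟨s₁, h₁, e₁⟩ := hrow 1 le_rfl (by omega) (Finset.Icc 1 (κ 1))
      obtain ⟨s₂, h₂, e₂⟩ := hrow 2 (by omega) (by omega) (Finset.Icc (κ 1 + 1) (κ 2))
      obtain ⟨s₃, h₃, e₃⟩ := exists_monomial_eq_prod (k := k) (ent m n hm0 hn0 m (n - 1))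
        (Finset.Icc 3 (m - 1))
        (fun r => ∏ i ∈ Finset.Icc (κ (r - 1) + 2) (κ r), X (ent m n hm0 hn0 r i))
        (fun r hr => by
          rw [Finset.mem_Icc] at hr
          exact hrow r (by omega) (by omega) _)
      refine ⟨s₁ + s₂ + s₃, by simp [h₁, h₂, h₃], ?_⟩
      rw [e₁, e₂, e₃, monomial_mul, monomial_mul, one_mul, one_mul]
  · refine le_inf Ideal.mul_le_left ?_
    rw [Ideal.span_mul_span', Ideal.span_le]
    rintro _ ⟨g, ⟨κ, h12, hlt, hκ, rfl⟩, _, rfl, rfl⟩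
    set κ' : ℕ → ℕ := fun r => if r = m then n - 1 else
      if r = 1 then min (κ 1) (n - m) else min (κ r) (n + r - 2 - m) with hκ'
    have k1 : κ' 1 = min (κ 1) (n - m) := by
      rw [hκ']; dsimp only; rw [if_neg (by omega), if_pos rfl]
    have km : κ' m = n - 1 := by rw [hκ']; dsimp only; rw [if_pos rfl]
    have kr : ∀ r, 2 ≤ r → r < m → κ' r = min (κ r) (n + r - 2 - m) := fun r h2 h => by
      rw [hκ']; dsimp only; rw [if_neg (by omega), if_neg (by omega)]
    clear_value κ'
    have k2 := kr 2 le_rfl (by omega)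
    have km1 := kr (m - 1) (by omega) (by omega)
    refine Ideal.mem_of_dvd _ ?_ (Ideal.subset_span ⟨κ', ?_, ?_, ?_, km, rfl⟩)
    · dsimp only
      rw [mul_assoc (_ * _)]
      refine mul_dvd_mul (mul_dvd_mul ?_ ?_) ?_
      · refine Finset.prod_dvd_prod_of_subset _ _ _ fun i hi => ?_
        rw [Finset.mem_Icc] at hi ⊢
        omega
      · refine Finset.prod_dvd_prod_of_subset _ _ _ fun i hi => ?_
        rw [Finset.mem_Icc] at hi ⊢
        omega
      · have hIcc : Finset.Icc 3 m = insert m (Finset.Icc 3 (m - 1)) := by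
          ext r
          simp only [Finset.mem_insert, Finset.mem_Icc]
          omega
        rw [hIcc, Finset.prod_insert (by simp only [Finset.mem_Icc]; omega), mul_comm]
        refine mul_dvd_mul (Finset.prod_dvd_prod_of_dvd _ _ fun r hr => ?_) ?_
        · rw [Finset.mem_Icc] at hr
          refine Finset.prod_dvd_prod_of_subset _ _ _ fun i hi => ?_
          have ha := kr r (by omega) (by omega)
          have hb := kr (r - 1) (by omega) (by omega)
          rw [Finset.mem_Icc] at hi ⊢
          omega
        · have hlast : Finset.Icc (κ' (m - 1) + 2) (κ' m) = {n - 1} := by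
            ext i
            rw [Finset.mem_Icc, Finset.mem_singleton]
            omega
          rw [hlast, Finset.prod_singleton]
    · omega
    · intro r h2 hr
      have := hlt r h2 hr
      have ha := kr r h2 (by omega)
      have hb := kr (r + 1) (by omega) (by omega)
      omega
    · omega
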